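/- Let f be a C^r local diffeomorphism of 𝕋², r ≥ 2, of degree d ≥ 2, with C(f) > 0 and inf_{x∈𝕋²} |det Df_x| > 1. There exist ε > 0, ρ > 0, N∈ℕ, λ > 1 and η > 0 such that for every C^r local diffeomorphism g of 𝕋² with d_{C²}(f,g) < η the following holds: for every (x,v)∈T¹𝕋², letting C(v,ε) = {w = (w₁,w₂) ∈ ℝv ⊕ ℝv^⊥ : |w₂| ≤ ε|w₁|} (a cone in ℝ², identified with each tangent space), there exists y∈g^{−N}(x) such that for every z in the ball B(y,ρ): (Dg^N_z)^{−1}(C(v,ε)) ⊆ C(v_y,ε), where v_y = (Dg^N_y)^{−1}v / ‖(Dg^N_y)^{−1}v‖, and ‖(Dg^N_z)^{−1}w‖ ≥ λ‖w‖ for every w∈C(v,ε). -/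

import Mathlib

open MeasureTheory Filter Topology Set
open scoped ENNReal NNReal

noncomputable section


open MeasureTheory Filter Topology Set
open scoped ENNReal NNReal

noncomputable section

instance fact_zero_lt_one' : Fact ((0:ℝ) < 1) := ⟨one_pos⟩

/-- The plane `ℝ²` with the Euclidean norm: the universal cover of the 2-torus and the
common model of all its tangent spaces. -/
abbrev V2 : Type := EuclideanSpace ℝ (Fin 2)

/-- The flat 2-torus `𝕋² = ℝ²/ℤ²`. -/
abbrev T2 : Type := AddCircle (1 : ℝ) × AddCircle (1 : ℝ)

/-- The covering projection `ℝ² → 𝕋²`. -/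
def proj (p : V2) : T2 := (↑(p 0), ↑(p 1))

/-- The integer vector `(m 0, m 1)` as an element of the plane. -/
def iv (m : Fin 2 → ℤ) : V2 := (WithLp.equiv 2 (Fin 2 → ℝ)).symm (fun i => (m i : ℝ))

/-- A `C^r` local diffeomorphism of the 2-torus, encoded by a `C^r` lift `F : ℝ² → ℝ²`
equivariant with respect to an integer linear part `A`, together with the induced map
`toFun` on the torus and its derivative cocycle `D` (tangent spaces being canonically `ℝ²`);
invertibility of `D` at every point expresses that the map is a local diffeomorphism. -/
structure TorusMap (r : ℕ) : Type where
  F : V2 → V2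
  contDiff : ContDiff ℝ r F
  A : Matrix (Fin 2) (Fin 2) ℤ
  equivar : ∀ (p : V2) (m : Fin 2 → ℤ), F (p + iv m) = F p + iv (A.mulVec m)
  toFun : T2 → T2
  toFun_proj : ∀ p : V2, toFun (proj p) = proj (F p)
  D : T2 → (V2 →L[ℝ] V2)
  D_proj : ∀ p : V2, D (proj p) = fderiv ℝ F p
  isUnit_D : ∀ x : T2, IsUnit (D x)

namespace TorusMap

variable {r : ℕ}

/-- The degree of `f`: the number of preimages of any point, `|det A|`. -/
def deg (f : TorusMap r) : ℕ := f.A.det.natAbs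

/-- The derivative of `f^[n]` at `x` (by the chain rule). -/
def Dn (f : TorusMap r) : ℕ → T2 → (V2 →L[ℝ] V2)
  | 0, _ => ContinuousLinearMap.id ℝ V2
  | n + 1, x => (Dn f n (f.toFun x)).comp (f.D x)

/-- The inverse `(Df^n_x)⁻¹` of the derivative of `f^[n]` at `x`. -/
def Dninv (f : TorusMap r) (n : ℕ) (x : T2) : V2 →L[ℝ] V2 := Ring.inverse (f.Dn n x)

/-- `I(x,v;fⁿ) = d^{-n} ∑_{y ∈ f^{-n}(x)} log ‖(Dfⁿ_y)⁻¹ · v‖`. -/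
def I (f : TorusMap r) (x : T2) (v : V2) (n : ℕ) : ℝ :=
  ((f.deg : ℝ) ^ n)⁻¹ * ∑ᶠ y ∈ (f.toFun^[n]) ⁻¹' {x}, Real.log ‖f.Dninv n y v‖

/-- `inf_{(x,v) ∈ T¹𝕋²} I(x,v;fⁿ)`. -/
def unifInf (f : TorusMap r) (n : ℕ) : ℝ :=
  ⨅ xv : T2 × Metric.sphere (0 : V2) 1, f.I xv.1 (xv.2 : V2) n

/-- `C(f) = liminf_{n→∞} (1/n) inf_{(x,v) ∈ T¹𝕋²} I(x,v;fⁿ)`. -/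
def C (f : TorusMap r) : ℝ := Filter.liminf (fun n : ℕ => f.unifInf n / n) Filter.atTop

/-- `I_f(x) = limsup_{n→∞} (1/n) inf_{v ∈ T¹_x𝕋²} I(x,v;fⁿ)`. -/
def Isup (f : TorusMap r) (x : T2) : ℝ :=
  Filter.limsup (fun n : ℕ => (⨅ v : Metric.sphere (0 : V2) 1, f.I x (v : V2) n) / n)
    Filter.atTop

/-- The determinant of the derivative of `f` at `x`. -/
def detD (f : TorusMap r) (x : T2) : ℝ := LinearMap.det (f.D x : V2 →ₗ[ℝ] V2)

/-- `μ` is an `f`-invariant measure. -/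
def Invariant (f : TorusMap r) (μ : Measure T2) : Prop :=
  ∀ s : Set T2, MeasurableSet s → μ (f.toFun ⁻¹' s) = μ s

/-- `μ` is equidistributed: `μ(f(A)) = d·μ(A)` for every Borel set `A` on which `f` is
injective (equivalently, `μ` maximizes the folding entropy: `F_μ(f) = log d`). -/
def Equidistributed (f : TorusMap r) (μ : Measure T2) : Prop :=
  ∀ s : Set T2, MeasurableSet s → Set.InjOn f.toFun s →
    μ (f.toFun '' s) = (f.deg : ℝ≥0∞) * μ s

end TorusMap

/-- The minimal norm (conorm) of a linear map of the plane. -/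
def minNorm (L : V2 →L[ℝ] V2) : ℝ := ⨅ v : Metric.sphere (0 : V2) 1, ‖L (v : V2)‖

/-- `ω` is a backward orbit of `x` under `f`. -/
def IsBackward {r : ℕ} (f : TorusMap r) (x : T2) (ω : ℕ → T2) : Prop :=
  ω 0 = x ∧ ∀ k, f.toFun (ω (k + 1)) = ω k

/-- The space of backward orbits of `x` under `f`. -/
abbrev Bw {r : ℕ} (f : TorusMap r) (x : T2) : Type := {ω : ℕ → T2 // IsBackward f x ω}

/-- `p` is the uniformly distributed (Bernoulli) measure on the backward orbits of `x`:
each of the `dⁿ` preimages `z ∈ f^{-n}(x)` carries mass `d^{-n}`. -/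
def IsBernoulliBw {r : ℕ} (f : TorusMap r) (x : T2) (p : Measure (Bw f x)) : Prop :=
  IsProbabilityMeasure p ∧
    ∀ (n : ℕ) (z : T2), f.toFun^[n] z = x →
      p {ω : Bw f x | ω.1 n = z} = ((f.deg : ℝ≥0∞) ^ n)⁻¹

/-- The `C^k` distance between two torus maps: sup distance between the values plus the sup
norms of the differences of the derivatives up to order `k`, computed via the lifts. -/
def distC {r : ℕ} (k : ℕ) (f g : TorusMap r) : ℝ :=
  (⨆ x : T2, dist (f.toFun x) (g.toFun x)) +
    ∑ i ∈ Finset.Icc 1 k, ⨆ p : V2, ‖iteratedFDeriv ℝ i f.F p - iteratedFDeriv ℝ i g.F p‖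

/-- The length of the curve `σ` (parametrized on `[-1,1]`). -/
def clen (σ : ℝ → V2) : ℝ := ∫ t in (-1 : ℝ)..1, ‖deriv σ t‖

open scoped RealInnerProductSpace

/-- `σ` is an `L`-Lipschitz graph centered at `x = σ(s₀)`: in the orthogonal splitting
`T_x𝕋² = ℝσ'(s₀) ⊕ ℝσ'(s₀)^⊥`, the curve coincides with (the exponential of) the graph of
an `L`-Lipschitz function. -/
def IsLipGraph (L : ℝ≥0) (σ : ℝ → V2) (s₀ : ℝ) : Prop :=
  ∃ (u w : V2) (φ : ℝ → ℝ) (J : Set ℝ),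
    ‖u‖ = 1 ∧ ‖w‖ = 1 ∧ ⟪u, w⟫ = 0 ∧ (∃ c : ℝ, 0 < c ∧ deriv σ s₀ = c • u) ∧
    LipschitzOnWith L φ J ∧
    σ '' Set.Icc (-1 : ℝ) 1 = (fun t => σ s₀ + t • u + φ t • w) '' J

/-- The cone of width `ε` around the direction `v`. -/
def cone (v : V2) (ε : ℝ) : Set V2 := {w | ‖w - ⟪w, v⟫ • v‖ ≤ ε * |⟪w, v⟫|}



/-! ### The projection -/

theorem proj_oq : IsOpenQuotientMap proj := by
  have h1 : IsOpenQuotientMap (fun a : ℝ => (a : AddCircle (1:ℝ))) :=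
    QuotientAddGroup.isOpenQuotientMap_mk
  have h2 := h1.prodMap h1
  let e : V2 ≃ₜ ℝ × ℝ := (PiLp.homeomorph 2 (fun _ : Fin 2 => ℝ)).trans (Homeomorph.piFinTwo (fun _ => ℝ))
  have h3 : IsOpenQuotientMap e := e.isOpenQuotientMap
  exact h2.comp h3

theorem coord_le (p : V2) (i : Fin 2) : |p i| ≤ ‖p‖ := by
  simpa using PiLp.norm_apply_le p i

theorem dist_proj_le (p q : V2) : dist (proj p) (proj q) ≤ dist p q := by
  have h : ∀ a b : ℝ, dist (a : AddCircle (1:ℝ)) (b : AddCircle (1:ℝ)) ≤ |a - b| := by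
    intro a b
    rw [dist_eq_norm, ← AddCircle.coe_sub]
    exact QuotientAddGroup.norm_mk_le_norm
  rw [Prod.dist_eq, dist_eq_norm p q]
  refine max_le ((h _ _).trans ?_) ((h _ _).trans ?_)
  · simpa using coord_le (p - q) 0
  · simpa using coord_le (p - q) 1

theorem norm_le_coord (u : V2) (a : ℝ) (h0 : |u 0| ≤ a) (h1 : |u 1| ≤ a) : ‖u‖ ≤ 2 * a := by
  have ha : 0 ≤ a := (abs_nonneg _).trans h0
  rw [EuclideanSpace.norm_eq, Fin.sum_univ_two]
  apply Real.sqrt_le_iff.2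
  refine ⟨by positivity, ?_⟩
  simp only [Real.norm_eq_abs]
  nlinarith [abs_nonneg (u 0), abs_nonneg (u 1)]

theorem exists_lift_near (a : V2) (x : T2) (t : ℝ) (h : dist (proj a) x < t) :
    ∃ b : V2, proj b = x ∧ ‖b - a‖ ≤ 2 * t := by
  obtain ⟨x0, x1⟩ := x
  have key : ∀ (c : ℝ) (y : AddCircle (1:ℝ)), dist (c : AddCircle (1:ℝ)) y < t →
      ∃ m : ℝ, ((c + m : ℝ) : AddCircle (1:ℝ)) = y ∧ |m| < t := by
    intro c y hy
    rw [dist_comm, dist_eq_norm] at hy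
    obtain ⟨m, hm, hm2⟩ := QuotientAddGroup.norm_lt_iff.1 hy
    refine ⟨m, ?_, hm2⟩
    rw [AddCircle.coe_add]
    have : (m : AddCircle (1:ℝ)) = y - c := hm
    rw [this]; abel
  rw [Prod.dist_eq] at h
  obtain ⟨m0, h0, h0'⟩ := key (a 0) x0 (lt_of_le_of_lt (le_max_left _ _) h)
  obtain ⟨m1, h1, h1'⟩ := key (a 1) x1 (lt_of_le_of_lt (le_max_right _ _) h)
  refine ⟨a + !₂[m0, m1], ?_, ?_⟩
  · simp only [proj]
    refine Prod.ext ?_ ?_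
    · simpa using h0
    · simpa using h1
  · rw [add_sub_cancel_left]
    exact norm_le_coord _ _ (by simpa using h0'.le) (by simpa using h1'.le)

namespace TorusMap

variable {r : ℕ}

theorem continuous_toFun (f : TorusMap r) : Continuous f.toFun := by
  rw [← proj_oq.continuous_comp_iff]
  have : f.toFun ∘ proj = proj ∘ f.F := funext f.toFun_proj
  rw [this]
  exact proj_oq.continuous.comp f.contDiff.continuous

theorem continuous_D (hr : 2 ≤ r) (f : TorusMap r) : Continuous f.D := by
  rw [← proj_oq.continuous_comp_iff]
  have : f.D ∘ proj = fderiv ℝ f.F := funext f.D_proj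
  rw [this]
  exact f.contDiff.continuous_fderiv (by norm_cast; omega)

theorem differentiable_F (hr : 2 ≤ r) (f : TorusMap r) : Differentiable ℝ f.F :=
  f.contDiff.differentiable (by norm_cast; omega)

theorem isUnit_Dn (f : TorusMap r) (n : ℕ) (x : T2) : IsUnit (f.Dn n x) := by
  induction n generalizing x with
  | zero => exact isUnit_one
  | succ n ih => exact (ih _).mul (f.isUnit_D x)

theorem iter_sub (hr : 2 ≤ r) (f g : TorusMap r) (p : V2) :
    ‖iteratedFDeriv ℝ 1 f.F p - iteratedFDeriv ℝ 1 g.F p‖ = ‖f.D (proj p) - g.D (proj p)‖ := by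
  have hf : ContDiff ℝ 1 f.F := f.contDiff.of_le (by norm_cast; omega)
  have hg : ContDiff ℝ 1 g.F := g.contDiff.of_le (by norm_cast; omega)
  have h := iteratedFDeriv_sub_apply (𝕜 := ℝ) (i := 1) (x := p) hf.contDiffAt hg.contDiffAt
  rw [← h, norm_iteratedFDeriv_one, f.D_proj, g.D_proj,
    fderiv_sub (f.differentiable_F hr p) (g.differentiable_F hr p)]

theorem dist_terms (hr : 2 ≤ r) (f g : TorusMap r) (x : T2) :
    dist (f.toFun x) (g.toFun x) ≤ distC 2 f g ∧ ‖f.D x - g.D x‖ ≤ distC 2 f g := by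
  have hs : ∑ i ∈ Finset.Icc 1 2, ⨆ p : V2, ‖iteratedFDeriv ℝ i f.F p - iteratedFDeriv ℝ i g.F p‖
      = (⨆ p : V2, ‖iteratedFDeriv ℝ 1 f.F p - iteratedFDeriv ℝ 1 g.F p‖) +
        ⨆ p : V2, ‖iteratedFDeriv ℝ 2 f.F p - iteratedFDeriv ℝ 2 g.F p‖ := by
    rw [show Finset.Icc 1 2 = {1, 2} from rfl, Finset.sum_pair (by norm_num)]
  have h2 : 0 ≤ ⨆ p : V2, ‖iteratedFDeriv ℝ 2 f.F p - iteratedFDeriv ℝ 2 g.F p‖ :=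
    Real.iSup_nonneg fun _ => norm_nonneg _
  have h1 : 0 ≤ ⨆ p : V2, ‖iteratedFDeriv ℝ 1 f.F p - iteratedFDeriv ℝ 1 g.F p‖ :=
    Real.iSup_nonneg fun _ => norm_nonneg _
  have h0 : 0 ≤ ⨆ x : T2, dist (f.toFun x) (g.toFun x) :=
    Real.iSup_nonneg fun _ => dist_nonneg
  have hb0 : BddAbove (Set.range fun x : T2 => dist (f.toFun x) (g.toFun x)) :=
    (isCompact_range (f.continuous_toFun.dist g.continuous_toFun)).bddAbove
  have hb1 : BddAbove (Set.range fun x : T2 => ‖f.D x - g.D x‖) :=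
    (isCompact_range ((f.continuous_D hr).sub (g.continuous_D hr)).norm).bddAbove
  unfold distC
  rw [hs]
  constructor
  · have := le_ciSup hb0 x
    linarith
  · obtain ⟨p, rfl⟩ := proj_oq.surjective x
    have hb : BddAbove (Set.range fun p : V2 =>
        ‖iteratedFDeriv ℝ 1 f.F p - iteratedFDeriv ℝ 1 g.F p‖) := by
      refine hb1.mono ?_
      rintro _ ⟨q, rfl⟩
      exact ⟨proj q, (iter_sub hr f g q).symm⟩
    have := le_ciSup hb p
    rw [iter_sub hr f g p] at this
    linarith

/-- The filter of torus maps close to `f`. -/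
def nb (f : TorusMap r) : Filter (TorusMap r) := ⨅ η ∈ Set.Ioi (0:ℝ), 𝓟 {g | distC 2 f g < η}

theorem nb_basis (f : TorusMap r) :
    f.nb.HasBasis (fun η : ℝ => 0 < η) (fun η => {g | distC 2 f g < η}) := by
  refine Filter.hasBasis_biInf_principal (s := fun η : ℝ => {g | distC 2 f g < η})
    (S := Set.Ioi (0:ℝ)) ?_ ⟨1, Set.mem_Ioi.2 one_pos⟩
  intro a ha b hb
  refine ⟨min a b, Set.mem_Ioi.2 (lt_min (Set.mem_Ioi.1 ha) (Set.mem_Ioi.1 hb)), ?_, ?_⟩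
  · intro g hg
    exact lt_of_lt_of_le (show distC 2 f g < min a b from hg) (min_le_left _ _)
  · intro g hg
    exact lt_of_lt_of_le (show distC 2 f g < min a b from hg) (min_le_right _ _)

theorem joint_of_le {β : Type*} [PseudoMetricSpace β] (f : TorusMap r) (Φ : TorusMap r → T2 → β)
    (hc : Continuous (Φ f)) (hd : ∀ g x, dist (Φ f x) (Φ g x) ≤ distC 2 f g) (x : T2) :
    Tendsto (fun p : TorusMap r × T2 => Φ p.1 p.2) (f.nb ×ˢ 𝓝 x) (𝓝 (Φ f x)) := by
  rw [Metric.tendsto_nhds]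
  intro e he
  have h1 : ∀ᶠ g in f.nb, distC 2 f g < e / 2 := f.nb_basis.mem_of_mem (half_pos he)
  have h2 : ∀ᶠ z in 𝓝 x, dist (Φ f z) (Φ f x) < e / 2 :=
    Metric.tendsto_nhds.1 hc.continuousAt _ (half_pos he)
  filter_upwards [h1.prod_mk h2] with p hp
  have := hd p.1 p.2
  have h3 := dist_triangle (Φ p.1 p.2) (Φ f p.2) (Φ f x)
  rw [dist_comm (Φ p.1 p.2) (Φ f p.2)] at h3
  linarith [hp.1, hp.2]

theorem joint_toFun (hr : 2 ≤ r) (f : TorusMap r) (x : T2) :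
    Tendsto (fun p : TorusMap r × T2 => p.1.toFun p.2) (f.nb ×ˢ 𝓝 x) (𝓝 (f.toFun x)) :=
  f.joint_of_le (fun g => g.toFun) f.continuous_toFun (fun g x => (dist_terms hr f g x).1) x

theorem joint_D (hr : 2 ≤ r) (f : TorusMap r) (x : T2) :
    Tendsto (fun p : TorusMap r × T2 => p.1.D p.2) (f.nb ×ˢ 𝓝 x) (𝓝 (f.D x)) :=
  f.joint_of_le (fun g => g.D) (f.continuous_D hr)
    (fun g x => by rw [dist_eq_norm]; exact (dist_terms hr f g x).2) x

theorem joint_Dn (hr : 2 ≤ r) (f : TorusMap r) (n : ℕ) (x : T2) :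
    Tendsto (fun p : TorusMap r × T2 => p.1.Dn n p.2) (f.nb ×ˢ 𝓝 x) (𝓝 (f.Dn n x)) := by
  induction n generalizing x with
  | zero => exact tendsto_const_nhds
  | succ n ih =>
    have h1 : Tendsto (fun p : TorusMap r × T2 => (p.1, p.1.toFun p.2)) (f.nb ×ˢ 𝓝 x)
        (f.nb ×ˢ 𝓝 (f.toFun x)) := tendsto_fst.prodMk (joint_toFun hr f x)
    exact ((ih (f.toFun x)).comp h1).mul (joint_D hr f x)

theorem joint_Dninv (hr : 2 ≤ r) (f : TorusMap r) (n : ℕ) (x : T2) :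
    Tendsto (fun p : TorusMap r × T2 => p.1.Dninv n p.2) (f.nb ×ˢ 𝓝 x) (𝓝 (f.Dninv n x)) := by
  obtain ⟨u, hu⟩ := f.isUnit_Dn n x
  have h := NormedRing.inverse_continuousAt u
  rw [hu] at h
  exact h.tendsto.comp (joint_Dn hr f n x)

theorem continuous_Dninv (hr : 2 ≤ r) (f : TorusMap r) (n : ℕ) : Continuous (f.Dninv n) := by
  rw [continuous_iff_continuousAt]
  intro x
  obtain ⟨u, hu⟩ := f.isUnit_Dn n x
  have h := NormedRing.inverse_continuousAt u
  rw [hu] at h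
  have hD : Continuous (f.Dn n) := by
    clear h hu u x
    induction n with
    | zero => exact continuous_const
    | succ n ih => exact (ih.comp f.continuous_toFun).mul (f.continuous_D hr)
  exact ContinuousAt.comp h hD.continuousAt

theorem uniform_Dninv (hr : 2 ≤ r) (f : TorusMap r) (n : ℕ) :
    TendstoUniformly (fun g : TorusMap r => g.Dninv n) (f.Dninv n) f.nb := by
  rw [← tendstoLocallyUniformly_iff_tendstoUniformly_of_compactSpace,
    tendstoLocallyUniformly_iff_forall_tendsto]
  intro x
  have h1 : Tendsto (fun p : TorusMap r × T2 => f.Dninv n p.2) (f.nb ×ˢ 𝓝 x)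
    (𝓝 (f.Dninv n x)) := ((f.continuous_Dninv hr n).tendsto x).comp tendsto_snd
  have h2 := h1.prodMk_nhds (joint_Dninv hr f n x)
  exact h2.mono_right (nhds_le_uniformity _)

/-- One-step shadowing of preimages. -/
theorem one_step (hr : 2 ≤ r) (f : TorusMap r) (δ : ℝ) (hδ : 0 < δ) :
    ∃ η : ℝ, 0 < η ∧ ∀ g : TorusMap r, distC 2 f g < η → ∀ y x' : T2,
      dist (f.toFun y) x' < η → ∃ y', dist y y' < δ ∧ g.toFun y' = x' := by
  obtain ⟨M, hM0, hM⟩ : ∃ M : ℝ≥0, 0 < M ∧ ∀ x, ‖Ring.inverse (f.D x)‖ ≤ M := by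
    have hc : Continuous fun x => ‖f.Dninv 1 x‖ := (f.continuous_Dninv hr 1).norm
    obtain ⟨B, hB⟩ := (isCompact_range hc).bddAbove
    refine ⟨(|B| + 1).toNNReal, Real.toNNReal_pos.2 (by positivity), fun x => ?_⟩
    have h1 : ‖f.Dninv 1 x‖ ≤ B := hB ⟨x, rfl⟩
    have h2 : f.Dninv 1 x = Ring.inverse (f.D x) := rfl
    rw [← h2, Real.coe_toNNReal _ (by positivity)]
    linarith [le_abs_self B]
  have hM0' : (0:ℝ) < M := hM0
  have huc := CompactSpace.uniformContinuous_of_continuous (f.continuous_D hr)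
  obtain ⟨s, hs, hsD⟩ := Metric.uniformContinuous_iff.1 huc (1 / (4 * M)) (by positivity)
  set t := min (s / 2) (δ / 2) with ht
  have ht0 : 0 < t := lt_min (half_pos hs) (half_pos hδ)
  refine ⟨min (1 / (4 * M)) (t / (8 * M)), by positivity, ?_⟩
  intro g hg y x' hx
  obtain ⟨p, rfl⟩ := proj_oq.surjective y
  have hg1 : distC 2 f g < 1 / (4 * M) := hg.trans_le (min_le_left _ _)
  have hg2 : distC 2 f g < t / (8 * M) := hg.trans_le (min_le_right _ _)
  have hx2 := hx.trans_le (min_le_right _ _)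
  have hd : dist (proj (g.F p)) x' < t / (4 * M) := by
    rw [← g.toFun_proj]
    have h1 := dist_triangle (g.toFun (proj p)) (f.toFun (proj p)) x'
    have h2 := (dist_terms hr f g (proj p)).1
    rw [dist_comm] at h2
    have : t / (4 * M) = t / (8 * M) + t / (8 * M) := by field_simp; norm_num
    linarith
  obtain ⟨b, hb, hba⟩ := exists_lift_near _ _ _ hd
  have happ : ApproximatesLinearOn g.F (f.D (proj p)) (Metric.closedBall p t) (2 * M)⁻¹ := by
    intro q hq q' hq'
    refine (convex_closedBall p t).norm_image_sub_le_of_norm_hasFDerivWithin_le'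
      (fun z _ => (g.differentiable_F hr z).hasFDerivAt.hasFDerivWithinAt) ?_ hq' hq
    intro z hz
    rw [← g.D_proj]
    have h1 := (dist_terms hr f g (proj z)).2
    rw [norm_sub_rev] at h1
    have h2 : dist (proj z) (proj p) < s := by
      refine (dist_proj_le z p).trans_lt ?_
      have : t ≤ s / 2 := min_le_left _ _
      have := Metric.mem_closedBall.1 hz
      linarith
    have h3 := hsD h2
    rw [dist_eq_norm] at h3
    have h4 := norm_sub_le_norm_sub_add_norm_sub (g.D (proj z)) (f.D (proj z)) (f.D (proj p))
    have h5 : (((2 * M)⁻¹ : ℝ≥0) : ℝ) = 1 / (4 * M) + 1 / (4 * M) := by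
      push_cast
      field_simp
      norm_num
    rw [h5]
    linarith
  let N : ContinuousLinearMap.NonlinearRightInverse (f.D (proj p)) :=
    { toFun := fun v => (Ring.inverse (f.D (proj p)) : V2 →L[ℝ] V2) v
      nnnorm := M
      bound' := fun v => (ContinuousLinearMap.le_opNorm _ v).trans
        (mul_le_mul_of_nonneg_right (hM _) (norm_nonneg _))
      right_inv' := fun v => by
        have := Ring.mul_inverse_cancel _ (f.isUnit_D (proj p))
        exact congrArg (fun L : V2 →L[ℝ] V2 => L v) this }
  have hsurj := happ.surjOn_closedBall_of_nonlinearRightInverse N ht0.le subset_rfl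
  have hbm : b ∈ Metric.closedBall (g.F p) (((N.nnnorm : ℝ)⁻¹ - ((2 * M)⁻¹ : ℝ≥0)) * t) := by
    rw [Metric.mem_closedBall, dist_eq_norm]
    refine hba.trans (le_of_eq ?_)
    change _ = ((M : ℝ)⁻¹ - _) * t
    push_cast
    field_simp
    norm_num
  obtain ⟨q, hq, hqb⟩ := hsurj hbm
  refine ⟨proj q, ?_, ?_⟩
  · refine (dist_proj_le p q).trans_lt ?_
    rw [dist_comm]
    have : t ≤ δ / 2 := min_le_right _ _
    have := Metric.mem_closedBall.1 hq
    linarith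
  · rw [g.toFun_proj, hqb, hb]

theorem many_step (hr : 2 ≤ r) (f : TorusMap r) (n : ℕ) (δ : ℝ) (hδ : 0 < δ) :
    ∃ η : ℝ, 0 < η ∧ ∀ g : TorusMap r, distC 2 f g < η → ∀ y x' : T2,
      dist (f.toFun^[n] y) x' < η → ∃ y', dist y y' < δ ∧ g.toFun^[n] y' = x' := by
  induction n generalizing δ with
  | zero => exact ⟨δ, hδ, fun g _ y x' h => ⟨x', h, rfl⟩⟩
  | succ n ih =>
    obtain ⟨δ1, hδ1, h1⟩ := one_step hr f δ hδ
    obtain ⟨η, hη, h2⟩ := ih δ1 hδ1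
    refine ⟨min η δ1, lt_min hη hδ1, ?_⟩
    intro g hg y x' hx
    rw [Function.iterate_succ_apply] at hx
    obtain ⟨y1, hy1, hy1'⟩ := h2 g (hg.trans_le (min_le_left _ _)) _ x' (hx.trans_le (min_le_left _ _))
    obtain ⟨y', hy', hy''⟩ := h1 g (hg.trans_le (min_le_right _ _)) y y1 hy1
    exact ⟨y', hy', by rw [Function.iterate_succ_apply, hy'', hy1']⟩

end TorusMap

/-! ### Plane geometry -/

/-- The signed area of the parallelogram spanned by two vectors of the plane. -/
def crs (u w : V2) : ℝ := u 0 * w 1 - u 1 * w 0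

theorem inner_two (u w : V2) : ⟪u, w⟫ = u 0 * w 0 + u 1 * w 1 := by
  rw [PiLp.inner_apply, Fin.sum_univ_two]
  simp only [real_inner_eq_re_inner, RCLike.inner_apply, conj_trivial, RCLike.re_to_real]
  ring

theorem norm_sq_two (u : V2) : ‖u‖ ^ 2 = u 0 ^ 2 + u 1 ^ 2 := by
  rw [EuclideanSpace.real_norm_sq_eq, Fin.sum_univ_two]

theorem perp_norm (u w : V2) (hu : ‖u‖ = 1) : ‖w - ⟪w, u⟫ • u‖ = |crs u w| := by
  rw [← abs_of_nonneg (norm_nonneg (w - ⟪w, u⟫ • u)), ← sq_eq_sq_iff_abs_eq_abs, norm_sq_two,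
    inner_two]
  have h := norm_sq_two u
  rw [hu] at h
  simp only [PiLp.sub_apply, PiLp.smul_apply, smul_eq_mul, crs]
  linear_combination (-(w 0 * u 0 + w 1 * u 1)^2) * h + (w 0 ^ 2 + w 1 ^ 2) * h

theorem crs_le (u w : V2) : |crs u w| ≤ ‖u‖ * ‖w‖ := by
  apply abs_le_of_sq_le_sq _ (by positivity)
  rw [mul_pow, norm_sq_two, norm_sq_two, crs]
  nlinarith [sq_nonneg (u 0 * w 0 + u 1 * w 1)]

theorem crs_map (L : V2 →L[ℝ] V2) (u w : V2) :
    crs (L u) (L w) = LinearMap.det (L : V2 →ₗ[ℝ] V2) * crs u w := by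
  rw [← LinearMap.det_toMatrix (EuclideanSpace.basisFun (Fin 2) ℝ).toBasis, Matrix.det_fin_two]
  have key : ∀ (x : V2) (i : Fin 2), L x i = x 0 * L (EuclideanSpace.single 0 1) i +
      x 1 * L (EuclideanSpace.single 1 1) i := by
    intro x i
    have hx : x = x 0 • EuclideanSpace.single 0 1 + x 1 • EuclideanSpace.single 1 1 := by
      ext j; fin_cases j <;> simp
    conv_lhs => rw [hx]
    simp
  simp only [LinearMap.toMatrix_apply, OrthonormalBasis.coe_toBasis, EuclideanSpace.basisFun_apply,
    OrthonormalBasis.coe_toBasis_repr_apply, EuclideanSpace.basisFun_repr,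
    ContinuousLinearMap.coe_coe]
  unfold crs
  rw [key u 0, key u 1, key w 0, key w 1]
  ring

theorem crs_perturb (a b a' b' : V2) :
    |crs a' b'| ≤ |crs a b| + ‖a' - a‖ * ‖b'‖ + ‖a‖ * ‖b' - b‖ := by
  have h : crs a' b' = crs a b + crs (a' - a) b' + crs a (b' - b) := by
    simp only [crs, PiLp.sub_apply]; ring
  rw [h]
  refine (abs_add_three _ _ _).trans ?_
  gcongr
  · exact crs_le _ _
  · exact crs_le _ _

set_option maxHeartbeats 1000000 in
/-- The linear-algebra core: cone contraction and expansion for perturbations of an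
area-nonincreasing map which expands `v`. -/
theorem cone_core (A0 A1 Az : V2 →L[ℝ] V2) (v : V2) (hv : ‖v‖ = 1) (t M ε κ : ℝ)
    (ht : 0 < t) (hM : 1 ≤ M) (hε : 0 < ε) (hε1 : ε ≤ 1) (hε2 : M ^ 2 * ε ≤ t)
    (hε3 : ε * (1 + t) ≤ t) (hκ0 : 0 < κ) (hκ1 : κ ≤ 1) (hκ2 : 2 * κ ≤ t)
    (hκ3 : 2 * κ * (2 * M + 1) ≤ t * ε)
    (hA : ‖A0‖ ≤ M) (hexp : 1 + 5 * t ≤ ‖A0 v‖) (hcrs : ∀ a b, |crs (A0 a) (A0 b)| ≤ |crs a b|)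
    (h1 : ‖A1 - A0‖ ≤ κ) (hz : ‖Az - A0‖ ≤ κ) (w : V2) (hw : w ∈ cone v ε) :
    Az w ∈ cone ((‖A1 v‖)⁻¹ • A1 v) ε ∧ (1 + t) * ‖w‖ ≤ ‖Az w‖ := by
  have hw' : ‖w - ⟪w, v⟫ • v‖ ≤ ε * |⟪w, v⟫| := hw
  set a := ⟪w, v⟫ with ha
  have hb := hw'
  rw [ha, perp_norm v w hv, ← ha] at hb
  set q := w - a • v with hq
  have hwq : w = a • v + q := by rw [hq]; abel
  have ha0 := abs_nonneg a
  have hwn : ‖w‖ ≤ (1 + ε) * |a| := by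
    calc ‖w‖ = ‖a • v + q‖ := by rw [← hwq]
      _ ≤ ‖a • v‖ + ‖q‖ := norm_add_le _ _
      _ ≤ (1 + ε) * |a| := by rw [norm_smul, hv, Real.norm_eq_abs]; linarith
  have hwn2 : ‖w‖ ≤ 2 * |a| := hwn.trans (mul_le_mul_of_nonneg_right (by linarith) ha0)
  have hop : ∀ (L : V2 →L[ℝ] V2) (c : ℝ), ‖L‖ ≤ c → ∀ x, ‖L x‖ ≤ c * ‖x‖ := fun L c h x =>
    (L.le_opNorm x).trans (mul_le_mul_of_nonneg_right h (norm_nonneg _))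
  have hAz : ‖Az w - A0 w‖ ≤ κ * ‖w‖ := hop (Az - A0) κ hz w
  have hA1 : ‖A1 v - A0 v‖ ≤ κ := by
    have := hop (A1 - A0) κ h1 v
    rwa [hv, mul_one] at this
  have hA0v : ‖A0 v‖ ≤ M := by
    have := hop A0 M hA v
    rwa [hv, mul_one] at this
  have hA0q : ‖A0 q‖ ≤ M * (ε * |a|) := (hop A0 M hA q).trans (by gcongr)
  have hA0w : ‖A0 w‖ ≤ M * ‖w‖ := hop A0 M hA w
  have hAzw : ‖Az w‖ ≤ (M + κ) * ‖w‖ := by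
    have := norm_le_norm_add_norm_sub' (Az w) (A0 w)
    linarith
  have hA0w' : A0 w = a • A0 v + A0 q := by rw [hwq]; simp
  have hw0 := norm_nonneg w
  constructor
  · have hpos : 0 < ‖A1 v‖ := by
      have := norm_le_norm_add_norm_sub' (A0 v) (A1 v)
      rw [norm_sub_rev] at this
      linarith
    set u := (‖A1 v‖)⁻¹ • A1 v with hu
    have hu1 : ‖u‖ = 1 := by
      rw [hu, norm_smul, norm_inv, norm_norm, inv_mul_cancel₀ hpos.ne']
    change ‖Az w - ⟪Az w, u⟫ • u‖ ≤ ε * |⟪Az w, u⟫|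
    rw [perp_norm u _ hu1]
    have e1 : crs u (Az w) = (‖A1 v‖)⁻¹ * crs (A1 v) (Az w) := by
      rw [hu]; simp only [crs, PiLp.smul_apply, smul_eq_mul]; ring
    have e2 : ⟪Az w, u⟫ = (‖A1 v‖)⁻¹ * ⟪Az w, A1 v⟫ := by
      rw [hu, inner_smul_right]
    rw [e1, e2, abs_mul, abs_mul, abs_of_pos (inv_pos.2 hpos), mul_left_comm]
    refine mul_le_mul_of_nonneg_left ?_ (inv_pos.2 hpos).le
    have herr : κ * ((M + κ) * ‖w‖) + M * (κ * ‖w‖) ≤ t * ε * |a| := by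
      calc κ * ((M + κ) * ‖w‖) + M * (κ * ‖w‖) = κ * (2 * M + κ) * ‖w‖ := by ring
        _ ≤ κ * (2 * M + 1) * (2 * |a|) := by gcongr
        _ = (2 * κ * (2 * M + 1)) * |a| := by ring
        _ ≤ t * ε * |a| := by gcongr
    have c1 : |crs (A1 v) (Az w)| ≤ ε * |a| + t * ε * |a| := by
      have h2 := crs_perturb (A0 v) (A0 w) (A1 v) (Az w)
      have h3 := hcrs v w
      have h4 : ‖A1 v - A0 v‖ * ‖Az w‖ ≤ κ * ((M + κ) * ‖w‖) := by gcongr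
      have h5 : ‖A0 v‖ * ‖Az w - A0 w‖ ≤ M * (κ * ‖w‖) := by gcongr
      linarith
    have c2 : |a| * (1 + 2 * t) ≤ |⟪Az w, A1 v⟫| := by
      have e3 : a * ‖A0 v‖ ^ 2 = ⟪Az w, A1 v⟫ - ⟪Az w, A1 v - A0 v⟫ - ⟪Az w - A0 w, A0 v⟫
          - ⟪A0 q, A0 v⟫ := by
        rw [inner_sub_right, inner_sub_left, hA0w', inner_add_left, inner_smul_left,
          real_inner_self_eq_norm_sq]
        simp
      have h4 : |⟪Az w, A1 v - A0 v⟫| ≤ κ * ((M + κ) * ‖w‖) :=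
        (abs_real_inner_le_norm _ _).trans (by rw [mul_comm]; gcongr)
      have h5 : |⟪Az w - A0 w, A0 v⟫| ≤ M * (κ * ‖w‖) :=
        (abs_real_inner_le_norm _ _).trans (by rw [mul_comm]; gcongr)
      have h6 : |⟪A0 q, A0 v⟫| ≤ t * |a| := by
        refine (abs_real_inner_le_norm _ _).trans ?_
        calc ‖A0 q‖ * ‖A0 v‖ ≤ (M * (ε * |a|)) * M := by gcongr
          _ = M ^ 2 * ε * |a| := by ring
          _ ≤ t * |a| := by gcongr
      have h7 : |a| * (1 + 10 * t) ≤ |a * ‖A0 v‖ ^ 2| := by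
        rw [abs_mul, abs_of_nonneg (sq_nonneg ‖A0 v‖)]
        have h10 : (1 + 5 * t) ^ 2 ≤ ‖A0 v‖ ^ 2 := by gcongr
        have h11 : 1 + 10 * t ≤ (1 + 5 * t) ^ 2 := by nlinarith only [sq_nonneg t]
        exact mul_le_mul_of_nonneg_left (h11.trans h10) ha0
      have h8 : t * ε * |a| ≤ t * |a| := by
        exact mul_le_mul_of_nonneg_right (mul_le_of_le_one_right ht.le hε1) ha0
      have h9 : |a * ‖A0 v‖ ^ 2| ≤ |⟪Az w, A1 v⟫| + |⟪Az w, A1 v - A0 v⟫| +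
          |⟪Az w - A0 w, A0 v⟫| + |⟪A0 q, A0 v⟫| := by
        rw [e3]
        refine (abs_sub _ _).trans ?_
        gcongr
        refine (abs_sub _ _).trans ?_
        gcongr
        exact abs_sub _ _
      have h10 := mul_nonneg ha0 ht.le
      linarith only [h4, h5, h6, h7, h8, h9, h10, herr]
    calc |crs (A1 v) (Az w)| ≤ ε * |a| + t * ε * |a| := c1
      _ ≤ ε * (|a| * (1 + 2 * t)) := by
          have h10 := mul_nonneg (mul_nonneg ha0 ht.le) hε.le
          linarith only [h10]
      _ ≤ _ := by gcongr
  · have h2 : |a| * ‖A0 v‖ ≤ ‖A0 w‖ + ‖A0 q‖ := by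
      have : a • A0 v = A0 w - A0 q := by rw [hA0w']; abel
      calc |a| * ‖A0 v‖ = ‖a • A0 v‖ := by rw [norm_smul, Real.norm_eq_abs]
        _ ≤ _ := by rw [this]; exact norm_sub_le _ _
    have h3 := norm_le_norm_add_norm_sub' (A0 w) (Az w)
    rw [norm_sub_rev] at h3
    have h4 : |a| * (1 + 5 * t) ≤ |a| * ‖A0 v‖ := by gcongr
    have h5 : M * (ε * |a|) ≤ t * |a| := by
      have h8 : M * ε ≤ M ^ 2 * ε :=
        mul_le_mul_of_nonneg_right (by nlinarith only [hM]) hε.le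
      have h9 := mul_le_mul_of_nonneg_right (h8.trans hε2) ha0
      linarith only [h9]
    have h6 : κ * ‖w‖ ≤ t * |a| := by
      have h8 := mul_le_mul_of_nonneg_left hwn2 hκ0.le
      have h9 := mul_le_mul_of_nonneg_right hκ2 ha0
      linarith only [h8, h9]
    have h7 : (1 + t) * ‖w‖ ≤ (1 + t) * ((1 + ε) * |a|) := by gcongr
    have h8 := mul_nonneg ha0 ht.le
    have h9 := mul_le_mul_of_nonneg_right hε3 ha0
    linarith only [h2, h3, h4, h5, h6, h7, h8, h9, hA0q, hAz]

namespace TorusMap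

variable {r : ℕ}

theorem crs_Dn (f : TorusMap r) (hdet : 1 < ⨅ x : T2, |f.detD x|) (n : ℕ) (x : T2) (a b : V2) :
    |crs a b| ≤ |crs (f.Dn n x a) (f.Dn n x b)| := by
  induction n generalizing x a b with
  | zero => exact le_rfl
  | succ n ih =>
    refine le_trans ?_ (ih (f.toFun x) (f.D x a) (f.D x b))
    rw [crs_map, abs_mul]
    have h1 : 1 < |f.detD x| := hdet.trans_le
      (ciInf_le ⟨0, by rintro _ ⟨y, rfl⟩; exact abs_nonneg _⟩ x)
    exact le_mul_of_one_le_left (abs_nonneg _) h1.le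

theorem crs_Dninv (f : TorusMap r) (hdet : 1 < ⨅ x : T2, |f.detD x|) (n : ℕ) (x : T2)
    (a b : V2) : |crs (f.Dninv n x a) (f.Dninv n x b)| ≤ |crs a b| := by
  have h := f.crs_Dn hdet n x (f.Dninv n x a) (f.Dninv n x b)
  have hc : ∀ c, f.Dn n x (f.Dninv n x c) = c := fun c =>
    congrArg (fun L : V2 →L[ℝ] V2 => L c) (Ring.mul_inverse_cancel _ (f.isUnit_Dn n x))
  rwa [hc, hc] at h

theorem exists_N (f : TorusMap r) (hC : 0 < f.C) :
    ∃ N : ℕ, ∀ (x : T2) (v : V2), ‖v‖ = 1 → ∃ y, f.toFun^[N] y = x ∧ 1 < ‖f.Dninv N y v‖ := by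
  have h1 : ∃ a : ℝ, 0 < a ∧ ∀ᶠ n : ℕ in atTop, a ≤ f.unifInf n / n := by
    unfold C at hC
    rw [Filter.liminf_eq] at hC
    by_contra hcon
    have : sSup {a : ℝ | ∀ᶠ n : ℕ in atTop, a ≤ f.unifInf n / n} ≤ 0 := by
      apply Real.sSup_nonpos
      intro a ha
      by_contra h
      exact hcon ⟨a, not_le.1 h, ha⟩
    linarith
  obtain ⟨a, ha, hev⟩ := h1
  obtain ⟨N, hN, hN1⟩ := (hev.and (eventually_ge_atTop 1)).exists
  refine ⟨N, fun x v hv => ?_⟩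
  have hpos : 0 < f.unifInf N := by
    by_contra h
    have : f.unifInf N / N ≤ 0 := div_nonpos_of_nonpos_of_nonneg (not_lt.1 h) (Nat.cast_nonneg _)
    linarith
  have hbdd : BddBelow (Set.range fun xv : T2 × Metric.sphere (0 : V2) 1 =>
      f.I xv.1 (xv.2 : V2) N) := by
    by_contra h
    have h0 : f.unifInf N = 0 := Real.sInf_of_not_bddBelow h
    linarith
  have hI : 0 < f.I x v N := hpos.trans_le
    (ciInf_le hbdd (x, (⟨v, by simpa using hv⟩ : Metric.sphere (0 : V2) 1)))
  by_contra hcon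
  push Not at hcon
  have hs : ∑ᶠ y ∈ (f.toFun^[N]) ⁻¹' {x}, Real.log ‖f.Dninv N y v‖ ≤ 0 := by
    rw [← neg_nonneg, ← finsum_neg_distrib]
    refine finsum_nonneg fun y => ?_
    rw [neg_nonneg]
    by_cases hy : y ∈ (f.toFun^[N]) ⁻¹' {x}
    · simp only [hy, finsum_true]
      exact Real.log_nonpos (norm_nonneg _) (hcon y hy)
    · simp only [hy, finsum_false, le_refl]
  have : f.I x v N ≤ 0 := mul_nonpos_of_nonneg_of_nonpos (by positivity) hs
  linarith

theorem exists_N_unif (hr : 2 ≤ r) (f : TorusMap r) (hC : 0 < f.C) :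
    ∃ N : ℕ, ∃ l : ℝ, 1 < l ∧ ∀ (x : T2) (v : V2), ‖v‖ = 1 →
      ∃ y, f.toFun^[N] y = x ∧ l ≤ ‖f.Dninv N y v‖ := by
  obtain ⟨N, hN⟩ := f.exists_N hC
  refine ⟨N, ?_⟩
  have hf0 : ∀ η : ℝ, 0 < η → distC 2 f f < η := by
    intro η hη
    simp [distC, hη]
  let P : Set (T2 × V2) → Prop := fun s => ∃ l : ℝ, 1 < l ∧ ∀ p ∈ s,
      ∃ y, f.toFun^[N] y = p.1 ∧ l ≤ ‖f.Dninv N y p.2‖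
  have hK : IsCompact ((Set.univ : Set T2) ×ˢ Metric.sphere (0 : V2) 1) :=
    isCompact_univ.prod (isCompact_sphere _ _)
  have : P ((Set.univ : Set T2) ×ˢ Metric.sphere (0 : V2) 1) := by
    refine hK.induction_on (p := P) ⟨2, by norm_num, by simp⟩ ?_ ?_ ?_
    · rintro s t hst ⟨l, hl, h⟩
      exact ⟨l, hl, fun p hp => h p (hst hp)⟩
    · rintro s t ⟨l, hl, h⟩ ⟨l', hl', h'⟩
      refine ⟨min l l', lt_min hl hl', ?_⟩
      rintro p (hp | hp)
      · obtain ⟨y, hy, hy'⟩ := h p hp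
        exact ⟨y, hy, (min_le_left _ _).trans hy'⟩
      · obtain ⟨y, hy, hy'⟩ := h' p hp
        exact ⟨y, hy, (min_le_right _ _).trans hy'⟩
    · rintro ⟨x, v⟩ ⟨-, hv⟩
      obtain ⟨y, hy, hy1⟩ := hN x v (by simpa using hv)
      obtain ⟨l, hl, hl'⟩ := exists_between hy1
      have hcont : Continuous fun p : T2 × V2 => ‖f.Dninv N p.1 p.2‖ :=
        (((f.continuous_Dninv hr N).comp continuous_fst).clm_apply continuous_snd).norm
      have hev : ∀ᶠ p : T2 × V2 in 𝓝 (y, v), l < ‖f.Dninv N p.1 p.2‖ :=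
        hcont.continuousAt.eventually (lt_mem_nhds hl')
      obtain ⟨δ, hδ, hball⟩ := Metric.eventually_nhds_iff.1 hev
      obtain ⟨η, hη, hstep⟩ := many_step hr f N δ hδ
      refine ⟨Metric.ball (x, v) (min δ η),
        mem_nhdsWithin_of_mem_nhds (Metric.ball_mem_nhds _ (lt_min hδ hη)), l, hl, ?_⟩
      rintro ⟨x', v'⟩ hp
      rw [Metric.mem_ball, Prod.dist_eq, max_lt_iff] at hp
      obtain ⟨y', hyy, hy'⟩ := hstep f (hf0 η hη) y x' (by
        rw [hy, dist_comm]; exact hp.1.trans_le (min_le_right _ _))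
      refine ⟨y', hy', (hball (y := (y', v')) ?_).le⟩
      rw [Prod.dist_eq, max_lt_iff]
      exact ⟨by rw [dist_comm]; exact hyy, hp.2.trans_le (min_le_left _ _)⟩
  obtain ⟨l, hl, h⟩ := this
  exact ⟨l, hl, fun x v hv => h (x, v) ⟨Set.mem_univ _, by simpa using hv⟩⟩

end TorusMap

/-- (Uniform cone expansion along some backward branch.) -/
theorem cone_expansion_along_preimages (r : ℕ) (hr : 2 ≤ r) (f : TorusMap r)
    (hdeg : 2 ≤ f.deg) (hC : 0 < f.C) (hdet : 1 < ⨅ x : T2, |f.detD x|) :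
    ∃ ε : ℝ, 0 < ε ∧ ∃ ρ : ℝ, 0 < ρ ∧ ∃ N : ℕ, ∃ lam : ℝ, 1 < lam ∧ ∃ η : ℝ, 0 < η ∧
      ∀ g : TorusMap r, distC 2 f g < η →
        ∀ (x : T2) (v : V2), ‖v‖ = 1 →
          ∃ y : T2, g.toFun^[N] y = x ∧
            ∀ z : T2, dist z y < ρ →
              (∀ w ∈ cone v ε,
                  g.Dninv N z w ∈ cone ((‖g.Dninv N y v‖)⁻¹ • g.Dninv N y v) ε) ∧
              (∀ w ∈ cone v ε, lam * ‖w‖ ≤ ‖g.Dninv N z w‖) := by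
  obtain ⟨N, l, hl, hN⟩ := f.exists_N_unif hr hC
  obtain ⟨M, hM1, hM⟩ : ∃ M : ℝ, 1 ≤ M ∧ ∀ x, ‖f.Dninv N x‖ ≤ M := by
    obtain ⟨B, hB⟩ := (isCompact_range (f.continuous_Dninv hr N).norm).bddAbove
    exact ⟨max 1 B, le_max_left _ _, fun x => (hB ⟨x, rfl⟩).trans (le_max_right _ _)⟩
  obtain ⟨t, ht, ht1, htl⟩ : ∃ t : ℝ, 0 < t ∧ t ≤ 1 ∧ 1 + 5 * t ≤ l := by
    refine ⟨min 1 ((l - 1) / 5), lt_min one_pos (by linarith), min_le_left _ _, ?_⟩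
    linarith [min_le_right 1 ((l - 1) / 5)]
  have hden : 0 < M ^ 2 + t + 1 := by positivity
  set ε := t / (M ^ 2 + t + 1) with hεd
  have hε : 0 < ε := by positivity
  have hεm : ε * (M ^ 2 + t + 1) = t := div_mul_cancel₀ _ hden.ne'
  have hε2 : M ^ 2 * ε ≤ t := by nlinarith
  have hε3 : ε * (1 + t) ≤ t := by nlinarith [sq_nonneg M]
  have hε1 : ε ≤ 1 := by nlinarith
  set κ := t * ε / (2 * (2 * M + 1)) with hκd
  have hM3 : 0 < 2 * (2 * M + 1) := by linarith
  have hκ : 0 < κ := by positivity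
  have hκm : κ * (2 * (2 * M + 1)) = t * ε := div_mul_cancel₀ _ hM3.ne'
  have hte : t * ε ≤ t := by nlinarith
  have hκ2 : 2 * κ ≤ t := by nlinarith
  have hκ1 : κ ≤ 1 := by linarith
  have huc := CompactSpace.uniformContinuous_of_continuous (f.continuous_Dninv hr N)
  obtain ⟨δ, hδ, hδD⟩ := Metric.uniformContinuous_iff.1 huc (κ / 2) (by positivity)
  have huni := Metric.tendstoUniformly_iff.1 (f.uniform_Dninv hr N) (κ / 2) (by positivity)
  obtain ⟨η1, hη1, huni⟩ := f.nb_basis.mem_iff.1 huni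
  obtain ⟨η2, hη2, hstep⟩ := TorusMap.many_step hr f N (δ / 2) (by positivity)
  refine ⟨ε, hε, δ / 2, by positivity, N, 1 + t, by linarith, min η1 η2, lt_min hη1 hη2, ?_⟩
  intro g hg x v hv
  obtain ⟨y0, hy0, hy0l⟩ := hN x v hv
  obtain ⟨y, hyd, hy⟩ := hstep g (hg.trans_le (min_le_right _ _)) y0 x
    (by rw [hy0, dist_self]; exact hη2)
  have hclose : ∀ z, dist z y < δ / 2 → ‖g.Dninv N z - f.Dninv N y0‖ ≤ κ := by
    intro z hz
    have h1 : dist z y0 < δ := by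
      have := dist_triangle z y y0
      rw [dist_comm y y0] at this
      linarith
    have h2 := hδD h1
    have h3 : dist (f.Dninv N z) (g.Dninv N z) < κ / 2 :=
      huni (show distC 2 f g < η1 from hg.trans_le (min_le_left _ _)) z
    have h4 := dist_triangle (g.Dninv N z) (f.Dninv N z) (f.Dninv N y0)
    rw [dist_comm (g.Dninv N z) (f.Dninv N z)] at h4
    rw [← dist_eq_norm]
    linarith
  have hcore : ∀ z, dist z y < δ / 2 → ∀ w ∈ cone v ε, _ := fun z hz w hw =>
    cone_core (f.Dninv N y0) (g.Dninv N y) (g.Dninv N z) v hv t M ε κ ht hM1 hε hε1 hε2 hε3 hκ hκ1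
      hκ2 (by linarith) (hM y0) (htl.trans hy0l) (f.crs_Dninv hdet N y0)
      (hclose y (by rw [dist_self]; positivity)) (hclose z hz) w hw
  exact ⟨y, hy, fun z hz => ⟨fun w hw => (hcore z hz w hw).1, fun w hw => (hcore z hz w hw).2⟩⟩

end
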